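/- arXiv:2006.04770 — 2 statements merged into one kernel-verified Lean document; each statement's English description precedes it below -/
import Mathlib

section
/- Let (α_λ, u_λ) solve −Δu_λ = λ(α_λ + u_λ)^p in Ω, ∫_Ω (α_λ + u_λ)^p = 1, u_λ ≥ 0 in Ω, u_λ = 0 on ∂Ω, α_λ > 0, with p > 1 and λ > 0, and let w_λ = du_λ/dλ solve −Δw_λ = τ_λ ρ_λ^{1/q}[w_λ]_λ + ρ_λ. If σ₁(α_λ, ψ_λ) > 0 then dα_λ/dλ = −<w_λ>_λ < 0. -/
open MeasureTheory Real Bornology Set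

noncomputable section

/-- Euclidean space ℝ^N. -/
abbrev EN (N : ℕ) := EuclideanSpace ℝ (Fin N)

/-- The Laplacian, as the sum of second derivatives in the coordinate directions. -/
def lap {N : ℕ} (f : EN N → ℝ) (x : EN N) : ℝ :=
  ∑ i : Fin N, iteratedFDeriv ℝ 2 f x ![EuclideanSpace.single i 1, EuclideanSpace.single i 1]

/-- The average of `η` over `Ω` with respect to the weight `w`. -/
def wavg {N : ℕ} (Ω : Set (EN N)) (w η : EN N → ℝ) : ℝ :=
  (∫ x in Ω, w x * η x) / ∫ x in Ω, w x

/-- Dirichlet energy ∫_Ω |∇φ|². -/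
def dirE {N : ℕ} (Ω : Set (EN N)) (φ : EN N → ℝ) : ℝ := ∫ x in Ω, ‖fderiv ℝ φ x‖ ^ 2

/-- Admissible (nontrivial) test functions: a smooth proxy for H¹₀(Ω) ∖ {0}. -/
def testfun {N : ℕ} (Ω : Set (EN N)) (φ : EN N → ℝ) : Prop :=
  ContDiff ℝ 2 φ ∧ (∀ x ∉ Ω, φ x = 0) ∧ ∃ x ∈ Ω, φ x ≠ 0

open Filter Topology

def thet (t : ℝ) : ℝ := Real.smoothTransition (t - 1)

lemma thet_cd : ContDiff ℝ 2 thet := by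
  have h : ContDiff ℝ (2 : ℕ∞) Real.smoothTransition := Real.smoothTransition.contDiff
  exact h.comp (contDiff_id.sub contDiff_const)

lemma thet_zero {t : ℝ} (h : t ≤ 1) : thet t = 0 :=
  Real.smoothTransition.zero_of_nonpos (by linarith)

lemma thet_one {t : ℝ} (h : 2 ≤ t) : thet t = 1 :=
  Real.smoothTransition.one_of_one_le (by linarith)

lemma thet_abs (t : ℝ) : |thet t| ≤ 1 := by
  unfold thet
  rw [abs_of_nonneg (Real.smoothTransition.nonneg _)]
  exact Real.smoothTransition.le_one _

lemma thet_deriv {t : ℝ} (h : 2 < t) : deriv thet t = 0 := by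
  have : thet =ᶠ[𝓝 t] fun _ => (1 : ℝ) := by
    filter_upwards [lt_mem_nhds h] with s hs using thet_one hs.le
  rw [this.deriv_eq]; simp

lemma thet_bd : ∃ C : ℝ, 0 ≤ C ∧ ∀ t : ℝ, 0 ≤ t → |deriv thet t * t| ≤ C := by
  have hc : Continuous fun t => deriv thet t * t :=
    (thet_cd.continuous_deriv (by norm_num)).mul continuous_id
  obtain ⟨C, hC⟩ := (isCompact_Icc (a := (0 : ℝ)) (b := 2)).exists_bound_of_continuousOn
    hc.continuousOn
  refine ⟨C, (norm_nonneg _).trans (hC 0 (by simp)), fun t ht => ?_⟩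
  rcases le_or_gt t 2 with h | h
  · exact hC t ⟨ht, h⟩
  · rw [thet_deriv h]; simpa using (norm_nonneg _).trans (hC 0 (by simp))

lemma norm_fd {N : ℕ} (L : EN N →L[ℝ] ℝ) :
    ‖L‖ ^ 2 = ∑ i : Fin N, L (EuclideanSpace.single i 1) ^ 2 := by
  obtain ⟨y, rfl⟩ := (InnerProductSpace.toDual ℝ (EN N)).surjective L
  rw [LinearIsometryEquiv.norm_map, EuclideanSpace.real_norm_sq_eq]
  simp [InnerProductSpace.toDual_apply_apply, EuclideanSpace.inner_single_right]

def gdot {N : ℕ} (L M : EN N →L[ℝ] ℝ) : ℝ :=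
  ∑ i : Fin N, L (EuclideanSpace.single i 1) * M (EuclideanSpace.single i 1)

lemma gdot_comm {N : ℕ} (L M : EN N →L[ℝ] ℝ) : gdot L M = gdot M L := by
  simp [gdot, mul_comm]

lemma gdot_self {N : ℕ} (L : EN N →L[ℝ] ℝ) : gdot L L = ‖L‖ ^ 2 := by
  rw [norm_fd]; simp [gdot, sq]

lemma gdot_cont {N : ℕ} : Continuous fun q : (EN N →L[ℝ] ℝ) × (EN N →L[ℝ] ℝ) => gdot q.1 q.2 := by
  unfold gdot
  fun_prop

lemma gdot_le {N : ℕ} (L M : EN N →L[ℝ] ℝ) : |gdot L M| ≤ N * (‖L‖ * ‖M‖) := by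
  unfold gdot
  refine (Finset.abs_sum_le_sum_abs _ _).trans ?_
  have : ∀ i ∈ (Finset.univ : Finset (Fin N)), |L (EuclideanSpace.single i 1) *
      M (EuclideanSpace.single i 1)| ≤ ‖L‖ * ‖M‖ := by
    intro i _
    rw [abs_mul]
    have h1 := L.le_opNorm (EuclideanSpace.single i 1)
    have h2 := M.le_opNorm (EuclideanSpace.single i 1)
    simp at h1 h2
    gcongr
  refine (Finset.sum_le_sum this).trans ?_
  simp

lemma lap_cont {N : ℕ} {f : EN N → ℝ} (hf : ContDiff ℝ 2 f) : Continuous (lap f) := by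
  unfold lap
  refine continuous_finsetSum _ fun i _ => ?_
  have := hf.continuous_iteratedFDeriv (m := 2) (by norm_num)
  fun_prop

lemma ibp {N : ℕ} {f g : EN N → ℝ} (hf : ContDiff ℝ 2 f) (hg : ContDiff ℝ 2 g)
    (hc : HasCompactSupport g) :
    ∫ x, g x * lap f x = - ∫ x, gdot (fderiv ℝ g x) (fderiv ℝ f x) := by
  have hg1 : Continuous (fderiv ℝ g) := hg.continuous_fderiv (by norm_num)
  have hf1 : Continuous (fderiv ℝ f) := hf.continuous_fderiv (by norm_num)
  have hf2 : ContDiff ℝ 1 (fderiv ℝ f) := hf.fderiv_right (by norm_num)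
  have hf3 : Continuous (fderiv ℝ (fderiv ℝ f)) := hf2.continuous_fderiv (by norm_num)
  have hgc := hg.continuous
  have key : ∀ x (i : Fin N), fderiv ℝ (fun y => fderiv ℝ f y (EuclideanSpace.single i 1)) x
      (EuclideanSpace.single i 1) =
      iteratedFDeriv ℝ 2 f x ![EuclideanSpace.single i 1, EuclideanSpace.single i 1] := by
    intro x i
    rw [iteratedFDeriv_two_apply]
    have hd : DifferentiableAt ℝ (fderiv ℝ f) x := (hf2.differentiable (by norm_num)) x
    rw [fderiv_clm_apply hd (differentiableAt_const _)]
    simp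
  have hd1 : ∀ i : Fin N, ContDiff ℝ 1 (fun y => fderiv ℝ f y (EuclideanSpace.single i 1)) :=
    fun i => hf2.clm_apply contDiff_const
  have hi1 : ∀ i : Fin N, Integrable (fun x => g x *
      fderiv ℝ (fun y => fderiv ℝ f y (EuclideanSpace.single i 1)) x
      (EuclideanSpace.single i 1)) := by
    intro i
    have := (hd1 i).continuous_fderiv (by norm_num)
    exact Continuous.integrable_of_hasCompactSupport (by fun_prop) hc.mul_right
  have hi2 : ∀ i : Fin N, Integrable (fun x => fderiv ℝ g x (EuclideanSpace.single i 1) *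
      fderiv ℝ f x (EuclideanSpace.single i 1)) := by
    intro i
    refine Continuous.integrable_of_hasCompactSupport (by fun_prop) ?_
    exact (hc.fderiv_apply (𝕜 := ℝ) _).mul_right
  have e1 : (fun x => g x * lap f x) = fun x => ∑ i : Fin N, g x *
      fderiv ℝ (fun y => fderiv ℝ f y (EuclideanSpace.single i 1)) x
      (EuclideanSpace.single i 1) := by
    ext x
    simp only [lap, Finset.mul_sum, key]
  rw [e1, integral_finsetSum _ fun i _ => hi1 i]
  unfold gdot
  rw [integral_finsetSum _ fun i _ => hi2 i, ← Finset.sum_neg_distrib]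
  refine Finset.sum_congr rfl fun i _ => ?_
  refine integral_mul_fderiv_eq_neg_fderiv_mul_of_integrable (hi2 i) (hi1 i) ?_ ?_ ?_
  · exact Continuous.integrable_of_hasCompactSupport (by fun_prop) hc.mul_right
  · exact fun x _ => hg.differentiable (by norm_num) x
  · exact fun x _ => (hd1 i).differentiable (by norm_num) x

/-- cutoff test function -/
def cut {N : ℕ} (Ω : Set (EN N)) (f v : EN N → ℝ) (n : ℕ) : EN N → ℝ :=
  Ω.indicator fun x => thet ((n : ℝ) ^ 2 * (f x ^ 2 + v x ^ 2)) * v x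

lemma cut_in {N : ℕ} {Ω : Set (EN N)} {f v : EN N → ℝ} {n : ℕ} {x : EN N} (hx : x ∈ Ω) :
    cut Ω f v n x = thet ((n : ℝ) ^ 2 * (f x ^ 2 + v x ^ 2)) * v x := by
  simp [cut, hx]

lemma cut_out {N : ℕ} {Ω : Set (EN N)} {f v : EN N → ℝ} {n : ℕ} {x : EN N} (hx : x ∉ Ω) :
    cut Ω f v n x = 0 := by
  simp [cut, hx]

lemma inner_cd {N : ℕ} {f v : EN N → ℝ} (hf : ContDiff ℝ 2 f) (hv : ContDiff ℝ 2 v) (n : ℕ) :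
    ContDiff ℝ 2 (fun x => thet ((n : ℝ) ^ 2 * (f x ^ 2 + v x ^ 2)) * v x) :=
  (thet_cd.comp (contDiff_const.mul ((hf.pow 2).add (hv.pow 2)))).mul hv

lemma cut_cd {N : ℕ} {Ω : Set (EN N)} (hΩ : IsOpen Ω) {f v : EN N → ℝ} (hf : ContDiff ℝ 2 f)
    (hv : ContDiff ℝ 2 v) (hfb : ∀ x ∈ frontier Ω, f x = 0) (hvb : ∀ x ∈ frontier Ω, v x = 0)
    (n : ℕ) : ContDiff ℝ 2 (cut Ω f v n) := by
  have hfc := hf.continuous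
  have hvc := hv.continuous
  rw [contDiff_iff_contDiffAt]
  intro x
  by_cases hx : x ∈ Ω
  · refine (inner_cd hf hv n).contDiffAt.congr_of_eventuallyEq ?_
    filter_upwards [hΩ.mem_nhds hx] with y hy using cut_in hy
  · refine (contDiffAt_const (c := (0 : ℝ))).congr_of_eventuallyEq ?_
    by_cases hxc : x ∈ closure Ω
    · have hfr : x ∈ frontier Ω := by rw [hΩ.frontier_eq]; exact ⟨hxc, hx⟩
      have hcont : Continuous fun y => (n : ℝ) ^ 2 * (f y ^ 2 + v y ^ 2) := by fun_prop
      have : ∀ᶠ y in 𝓝 x, (n : ℝ) ^ 2 * (f y ^ 2 + v y ^ 2) < 1 := by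
        refine hcont.continuousAt.eventually_lt continuousAt_const ?_
        simp [hfb x hfr, hvb x hfr]
      filter_upwards [this] with y hy
      by_cases hyΩ : y ∈ Ω
      · rw [cut_in hyΩ, thet_zero hy.le, zero_mul]
      · exact cut_out hyΩ
    · filter_upwards [isClosed_closure.isOpen_compl.mem_nhds hxc] with y hy
      exact cut_out fun h => hy (subset_closure h)

lemma cut_cs {N : ℕ} {Ω : Set (EN N)} (hb : IsBounded Ω) (f v : EN N → ℝ) (n : ℕ) :
    HasCompactSupport (cut Ω f v n) := by
  refine HasCompactSupport.intro hb.isCompact_closure (fun x hx => ?_)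
  exact cut_out fun h => hx (subset_closure h)

lemma cut_fd {N : ℕ} {Ω : Set (EN N)} (hΩ : IsOpen Ω) {f v : EN N → ℝ} (hf : ContDiff ℝ 2 f)
    (hv : ContDiff ℝ 2 v) (n : ℕ) {x : EN N} (hx : x ∈ Ω) :
    fderiv ℝ (cut Ω f v n) x = thet ((n : ℝ) ^ 2 * (f x ^ 2 + v x ^ 2)) • fderiv ℝ v x +
      (v x * deriv thet ((n : ℝ) ^ 2 * (f x ^ 2 + v x ^ 2)) * (n : ℝ) ^ 2 * 2 * f x) • fderiv ℝ f x
      + (v x * deriv thet ((n : ℝ) ^ 2 * (f x ^ 2 + v x ^ 2)) * (n : ℝ) ^ 2 * 2 * v x)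
        • fderiv ℝ v x := by
  have he : cut Ω f v n =ᶠ[𝓝 x] fun x => thet ((n : ℝ) ^ 2 * (f x ^ 2 + v x ^ 2)) * v x := by
    filter_upwards [hΩ.mem_nhds hx] with y hy using cut_in hy
  rw [he.fderiv_eq]
  have h1 : HasFDerivAt f (fderiv ℝ f x) x := (hf.differentiable (by norm_num) x).hasFDerivAt
  have h2 : HasFDerivAt v (fderiv ℝ v x) x := (hv.differentiable (by norm_num) x).hasFDerivAt
  have h3 := ((h1.pow 2).add (h2.pow 2)).const_mul ((n : ℝ) ^ 2)
  have h4 : HasDerivAt thet (deriv thet ((n : ℝ) ^ 2 * (f x ^ 2 + v x ^ 2)))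
      ((n : ℝ) ^ 2 * (f x ^ 2 + v x ^ 2)) :=
    (thet_cd.differentiable (by norm_num) _).hasDerivAt
  have h5 := (HasDerivAt.comp_hasFDerivAt x h4 h3).mul h2
  refine h5.fderiv.trans ?_
  ext y
  simp
  ring

lemma cut_abs {N : ℕ} (Ω : Set (EN N)) (f v : EN N → ℝ) (n : ℕ) (x : EN N) :
    |cut Ω f v n x| ≤ |v x| := by
  by_cases hx : x ∈ Ω
  · rw [cut_in hx, abs_mul]
    exact mul_le_of_le_one_left (abs_nonneg _) (thet_abs _)
  · rw [cut_out hx]; simp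

lemma ev_large {s : ℝ} (hs : 0 < s) : ∀ᶠ n : ℕ in atTop, 2 < (n : ℝ) ^ 2 * s := by
  have : Tendsto (fun n : ℕ => (n : ℝ) ^ 2 * s) atTop atTop :=
    ((tendsto_pow_atTop (two_ne_zero)).comp tendsto_natCast_atTop_atTop).atTop_mul_const hs
  exact this.eventually_gt_atTop 2

lemma sq_zero {a b : ℝ} (h : ¬ 0 < a ^ 2 + b ^ 2) : a = 0 ∧ b = 0 := by
  constructor <;> nlinarith [sq_nonneg a, sq_nonneg b]

lemma cut_lim {N : ℕ} {Ω : Set (EN N)} (f v : EN N → ℝ) {x : EN N} (hx : x ∈ Ω) :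
    Tendsto (fun n => cut Ω f v n x) atTop (𝓝 (v x)) := by
  by_cases h : 0 < f x ^ 2 + v x ^ 2
  · refine tendsto_const_nhds.congr' ?_
    filter_upwards [ev_large h] with n hn
    rw [cut_in hx, thet_one hn.le, one_mul]
  · have := (sq_zero h).2
    simp [cut_in hx, this]

lemma cut_fdlim {N : ℕ} {Ω : Set (EN N)} (hΩ : IsOpen Ω) {f v : EN N → ℝ} (hf : ContDiff ℝ 2 f)
    (hv : ContDiff ℝ 2 v) {x : EN N} (hx : x ∈ Ω) :
    Tendsto (fun n => fderiv ℝ (cut Ω f v n) x) atTop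
      (𝓝 ({x | 0 < f x ^ 2 + v x ^ 2}.indicator (fderiv ℝ v) x)) := by
  by_cases h : 0 < f x ^ 2 + v x ^ 2
  · rw [indicator_of_mem (by exact h)]
    refine tendsto_const_nhds.congr' ?_
    filter_upwards [ev_large h] with n hn
    rw [cut_fd hΩ hf hv n hx, thet_one hn.le, thet_deriv hn]
    simp
  · rw [indicator_of_notMem (by exact h)]
    obtain ⟨h1, h2⟩ := sq_zero h
    have : ∀ n, fderiv ℝ (cut Ω f v n) x = 0 := by
      intro n
      rw [cut_fd hΩ hf hv n hx, h1, h2, thet_zero (by simp)]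
      simp
    simp [this]

lemma cut_fdbd {N : ℕ} {Ω : Set (EN N)} (hΩ : IsOpen Ω) {f v : EN N → ℝ} (hf : ContDiff ℝ 2 f)
    (hv : ContDiff ℝ 2 v) : ∃ C : ℝ, 0 ≤ C ∧ ∀ x ∈ Ω, ∀ n,
      ‖fderiv ℝ (cut Ω f v n) x‖ ≤ C * (‖fderiv ℝ f x‖ + ‖fderiv ℝ v x‖) := by
  obtain ⟨C, hC0, hC⟩ := thet_bd
  refine ⟨1 + 2 * C, by positivity, fun x hx n => ?_⟩
  rw [cut_fd hΩ hf hv n hx]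
  set s := f x ^ 2 + v x ^ 2 with hs
  have hs0 : 0 ≤ s := by positivity
  have hD := hC ((n : ℝ) ^ 2 * s) (by positivity)
  set D := deriv thet ((n : ℝ) ^ 2 * s)
  have b1 : |v x * D * (n : ℝ) ^ 2 * 2 * f x| ≤ 2 * C := by
    have : |v x * D * (n : ℝ) ^ 2 * 2 * f x| = |D| * (n : ℝ) ^ 2 * (2 * (|v x| * |f x|)) := by
      simp [abs_mul]; ring
    rw [this]
    have h2 : |v x| * |f x| ≤ s := by
      rw [hs, ← sq_abs (f x), ← sq_abs (v x)]; nlinarith [sq_nonneg (|v x| - |f x|), abs_nonneg (v x), abs_nonneg (f x), mul_nonneg (abs_nonneg (v x)) (abs_nonneg (f x))]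
    rw [abs_mul, abs_of_nonneg (by positivity : 0 ≤ (n : ℝ) ^ 2 * s)] at hD
    calc |D| * (n : ℝ) ^ 2 * (2 * (|v x| * |f x|)) ≤ |D| * (n : ℝ) ^ 2 * (2 * s) := by gcongr
      _ ≤ 2 * C := by linarith
  have b2 : |v x * D * (n : ℝ) ^ 2 * 2 * v x| ≤ 2 * C := by
    have : |v x * D * (n : ℝ) ^ 2 * 2 * v x| = |D| * (n : ℝ) ^ 2 * (2 * (|v x| * |v x|)) := by
      simp only [abs_mul, abs_pow, Nat.abs_cast, Nat.abs_ofNat]; ring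
    rw [this]
    have h2 : |v x| * |v x| ≤ s := by
      rw [hs, abs_mul_abs_self]; nlinarith [sq_nonneg (f x)]
    rw [abs_mul, abs_of_nonneg (by positivity : 0 ≤ (n : ℝ) ^ 2 * s)] at hD
    calc |D| * (n : ℝ) ^ 2 * (2 * (|v x| * |v x|)) ≤ |D| * (n : ℝ) ^ 2 * (2 * s) := by gcongr
      _ ≤ 2 * C := by linarith
  have b0 := thet_abs ((n : ℝ) ^ 2 * s)
  refine (norm_add₃_le).trans ?_
  rw [norm_smul, norm_smul, norm_smul, Real.norm_eq_abs, Real.norm_eq_abs, Real.norm_eq_abs]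
  have n1 := norm_nonneg (fderiv ℝ f x)
  have n2 := norm_nonneg (fderiv ℝ v x)
  have := mul_le_mul_of_nonneg_right b0 n2
  have := mul_le_mul_of_nonneg_right b1 n1
  have := mul_le_mul_of_nonneg_right b2 n2
  nlinarith

lemma dct {N : ℕ} {Ω : Set (EN N)} (hΩ : IsOpen Ω) (hvol : volume Ω = 1) {F : ℕ → EN N → ℝ}
    {G : EN N → ℝ} (K : ℝ) (hF : ∀ n, ContinuousOn (F n) Ω) (hK : ∀ n, ∀ x ∈ Ω, |F n x| ≤ K)
    (hl : ∀ x ∈ Ω, Tendsto (fun n => F n x) atTop (𝓝 (G x))) :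
    Tendsto (fun n => ∫ x in Ω, F n x) atTop (𝓝 (∫ x in Ω, G x)) := by
  have : IsFiniteMeasure (volume.restrict Ω) := ⟨by simp [hvol]⟩
  refine tendsto_integral_of_dominated_convergence (fun _ => K)
    (fun n => (hF n).aestronglyMeasurable hΩ.measurableSet) (integrable_const _) ?_ ?_
  · intro n
    filter_upwards [ae_restrict_mem hΩ.measurableSet] with x hx using hK n x hx
  · filter_upwards [ae_restrict_mem hΩ.measurableSet] with x hx using hl x hx

lemma bdd_on {N : ℕ} {Ω : Set (EN N)} (hb : IsBounded Ω) {F : Type*} [NormedAddCommGroup F]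
    {f : EN N → F} (hf : Continuous f) :
    ∃ C : ℝ, 0 ≤ C ∧ ∀ x ∈ Ω, ‖f x‖ ≤ C := by
  obtain ⟨C, hC⟩ := hb.isCompact_closure.exists_bound_of_continuousOn hf.continuousOn
  exact ⟨|C|, abs_nonneg _, fun x hx => (hC x (subset_closure hx)).trans (le_abs_self _)⟩

lemma green {N : ℕ} {Ω : Set (EN N)} (hΩ : IsOpen Ω) (hb : IsBounded Ω) (hvol : volume Ω = 1)
    {f v : EN N → ℝ} (hf : ContDiff ℝ 2 f)
    (hv : ContDiff ℝ 2 v) (hfb : ∀ x ∈ frontier Ω, f x = 0) (hvb : ∀ x ∈ frontier Ω, v x = 0) :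
    ∫ x in Ω, v x * lap f x =
      - ∫ x in Ω, gdot ({x | 0 < f x ^ 2 + v x ^ 2}.indicator (fderiv ℝ v) x) (fderiv ℝ f x) := by
  have hcd := cut_cd hΩ hf hv hfb hvb
  have hf1 : Continuous (fderiv ℝ f) := hf.continuous_fderiv (by norm_num)
  have hv1 : Continuous (fderiv ℝ v) := hv.continuous_fderiv (by norm_num)
  have hlc := lap_cont hf
  have hn : ∀ n, ∫ x in Ω, cut Ω f v n x * lap f x =
      - ∫ x in Ω, gdot (fderiv ℝ (cut Ω f v n) x) (fderiv ℝ f x) := by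
    intro n
    rw [setIntegral_eq_integral_of_forall_compl_eq_zero, setIntegral_eq_integral_of_forall_compl_eq_zero]
    · exact ibp hf (hcd n) (cut_cs hb f v n)
    · intro x hx
      have : fderiv ℝ (cut Ω f v n) x = 0 := by
        by_cases hxc : x ∈ closure Ω
        · have hfr : x ∈ frontier Ω := by rw [hΩ.frontier_eq]; exact ⟨hxc, hx⟩
          have hcont : Continuous fun y => (n : ℝ) ^ 2 * (f y ^ 2 + v y ^ 2) := by
            have := hf.continuous
            have := hv.continuous
            fun_prop
          have : ∀ᶠ y in 𝓝 x, (n : ℝ) ^ 2 * (f y ^ 2 + v y ^ 2) < 1 := by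
            refine hcont.continuousAt.eventually_lt continuousAt_const ?_
            simp [hfb x hfr, hvb x hfr]
          have h2 : cut Ω f v n =ᶠ[𝓝 x] fun _ => (0 : ℝ) := by
            filter_upwards [this] with y hy
            by_cases hyΩ : y ∈ Ω
            · rw [cut_in hyΩ, thet_zero hy.le, zero_mul]
            · exact cut_out hyΩ
          rw [h2.fderiv_eq]; simp
        · have h2 : cut Ω f v n =ᶠ[𝓝 x] fun _ => (0 : ℝ) := by
            filter_upwards [isClosed_closure.isOpen_compl.mem_nhds hxc] with y hy
            exact cut_out fun h => hy (subset_closure h)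
          rw [h2.fderiv_eq]; simp
      rw [this]; simp [gdot]
    · intro x hx
      rw [cut_out hx, zero_mul]
  obtain ⟨Cv, hCv0, hCv⟩ := bdd_on hb hv.continuous
  obtain ⟨Cl, hCl0, hCl⟩ := bdd_on hb hlc
  obtain ⟨D, hD0, hD⟩ := bdd_on hb hf1
  obtain ⟨E, hE0, hE⟩ := bdd_on hb hv1
  obtain ⟨C, hC0, hC⟩ := cut_fdbd hΩ hf hv
  have l1 : Tendsto (fun n => ∫ x in Ω, cut Ω f v n x * lap f x) atTop
      (𝓝 (∫ x in Ω, v x * lap f x)) := by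
    refine dct hΩ hvol (Cv * Cl) (fun n => ((hcd n).continuous.mul hlc).continuousOn) ?_ ?_
    · intro n x hx
      rw [abs_mul]
      have h1 := (cut_abs Ω f v n x).trans (hCv x hx)
      have h2 := hCl x hx
      rw [Real.norm_eq_abs] at h2
      gcongr
    · intro x hx
      exact (cut_lim f v hx).mul_const _
  have l2 : Tendsto (fun n => ∫ x in Ω, gdot (fderiv ℝ (cut Ω f v n) x) (fderiv ℝ f x)) atTop
      (𝓝 (∫ x in Ω, gdot ({x | 0 < f x ^ 2 + v x ^ 2}.indicator (fderiv ℝ v) x)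
        (fderiv ℝ f x))) := by
    refine dct hΩ hvol (N * (C * (D + E) * D)) (fun n => ?_) ?_ ?_
    · have : Continuous (fderiv ℝ (cut Ω f v n)) := (hcd n).continuous_fderiv (by norm_num)
      exact (gdot_cont.comp (this.prodMk hf1)).continuousOn
    · intro n x hx
      refine (gdot_le _ _).trans ?_
      have h1 := hC x hx n
      have h2 := hD x hx
      have h3 := hE x hx
      have h4 : ‖fderiv ℝ (cut Ω f v n) x‖ ≤ C * (D + E) := h1.trans (by gcongr)
      gcongr
    · intro x hx
      exact (gdot_cont.tendsto _).comp ((cut_fdlim hΩ hf hv hx).prodMk_nhds tendsto_const_nhds)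
  refine tendsto_nhds_unique l1 ?_
  simp_rw [hn]
  exact l2.neg

lemma green_symm {N : ℕ} {Ω : Set (EN N)} (hΩ : IsOpen Ω) (hb : IsBounded Ω) (hvol : volume Ω = 1)
    {f v : EN N → ℝ} (hf : ContDiff ℝ 2 f)
    (hv : ContDiff ℝ 2 v) (hfb : ∀ x ∈ frontier Ω, f x = 0) (hvb : ∀ x ∈ frontier Ω, v x = 0) :
    ∫ x in Ω, v x * lap f x = ∫ x in Ω, f x * lap v x := by
  rw [green hΩ hb hvol hf hv hfb hvb, green hΩ hb hvol hv hf hvb hfb]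
  congr 2
  ext x
  by_cases h : 0 < f x ^ 2 + v x ^ 2
  · rw [indicator_of_mem (by exact h), indicator_of_mem (by simpa [add_comm] using h), gdot_comm]
  · rw [indicator_of_notMem (by exact h), indicator_of_notMem (by simpa [add_comm] using h)]
    simp [gdot]

lemma dirE_lim {N : ℕ} {Ω : Set (EN N)} (hΩ : IsOpen Ω) (hb : IsBounded Ω) (hvol : volume Ω = 1)
    {v : EN N → ℝ} (hv : ContDiff ℝ 2 v) (hvb : ∀ x ∈ frontier Ω, v x = 0) :
    Tendsto (fun n => dirE Ω (cut Ω v v n)) atTop (𝓝 (- ∫ x in Ω, v x * lap v x)) := by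
  have hcd := cut_cd hΩ hv hv hvb hvb
  have hv1 : Continuous (fderiv ℝ v) := hv.continuous_fderiv (by norm_num)
  obtain ⟨E, hE0, hE⟩ := bdd_on hb hv1
  obtain ⟨C, hC0, hC⟩ := cut_fdbd hΩ hv hv
  rw [green hΩ hb hvol hv hv hvb hvb, neg_neg]
  unfold dirE
  refine dct hΩ hvol ((C * (E + E)) ^ 2) (fun n => ?_) ?_ ?_
  · have : Continuous (fderiv ℝ (cut Ω v v n)) := (hcd n).continuous_fderiv (by norm_num)
    exact (this.norm.pow 2).continuousOn
  · intro n x hx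
    have h1 := hC x hx n
    have h3 := hE x hx
    rw [abs_of_nonneg (by positivity)]
    have : ‖fderiv ℝ (cut Ω v v n) x‖ ≤ C * (E + E) := h1.trans (by gcongr)
    gcongr
  · intro x hx
    have := ((cut_fdlim hΩ hv hv hx).norm.pow 2)
    convert this using 2
    by_cases h : 0 < v x ^ 2 + v x ^ 2
    · rw [indicator_of_mem (by exact h), gdot_self]
    · rw [indicator_of_notMem (by exact h)]
      simp [gdot]


lemma int_on {N : ℕ} {Ω : Set (EN N)} (hΩ : IsOpen Ω) (hvol : volume Ω = 1) {F : EN N → ℝ}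
    (K : ℝ) (hF : ContinuousOn F Ω) (hK : ∀ x ∈ Ω, |F x| ≤ K) :
    IntegrableOn F Ω := by
  have : IsFiniteMeasure (volume.restrict Ω) := ⟨by simp [hvol]⟩
  refine Integrable.of_bound (hF.aestronglyMeasurable hΩ.measurableSet) K ?_
  filter_upwards [ae_restrict_mem hΩ.measurableSet] with x hx using hK x hx

lemma lin4 {N : ℕ} {Ω : Set (EN N)} {f g h k : EN N → ℝ} (hf : IntegrableOn f Ω)
    (hg : IntegrableOn g Ω) (hh : IntegrableOn h Ω) (hk : IntegrableOn k Ω) (a b c d : ℝ) :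
    ∫ x in Ω, (a * f x + b * g x + c * h x + d * k x) = a * (∫ x in Ω, f x) + b * (∫ x in Ω, g x)
      + c * (∫ x in Ω, h x) + d * ∫ x in Ω, k x := by
  have h1 : IntegrableOn (fun x => a * f x) Ω := hf.const_mul a
  have h2 : IntegrableOn (fun x => b * g x) Ω := hg.const_mul b
  have h3 : IntegrableOn (fun x => c * h x) Ω := hh.const_mul c
  have h4 : IntegrableOn (fun x => d * k x) Ω := hk.const_mul d
  have h12 : IntegrableOn (fun x => a * f x + b * g x) Ω := h1.add h2
  have h123 : IntegrableOn (fun x => a * f x + b * g x + c * h x) Ω := h12.add h3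
  rw [integral_add h123 h4, integral_add h12 h3, integral_add h1 h2]
  simp only [integral_const_mul]

lemma var_eq {N : ℕ} {Ω : Set (EN N)} {w φ : EN N → ℝ} (hm : ∫ x in Ω, w x ≠ 0)
    (h0 : IntegrableOn w Ω) (h1 : IntegrableOn (fun x => w x * φ x) Ω)
    (h2 : IntegrableOn (fun x => w x * φ x ^ 2) Ω) :
    ∫ x in Ω, w x * (φ x - wavg Ω w φ) ^ 2 =
      (∫ x in Ω, w x * φ x ^ 2) - (∫ x in Ω, w x * φ x) ^ 2 / ∫ x in Ω, w x := by
  have e : (fun x => w x * (φ x - wavg Ω w φ) ^ 2) = fun x => 1 * (w x * φ x ^ 2) +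
      (-2 * wavg Ω w φ) * (w x * φ x) + wavg Ω w φ ^ 2 * w x + 0 * w x := by
    ext x; ring
  rw [e, lin4 h2 h1 h0 h0]
  unfold wavg
  field_simp
  ring

/-- For `p > 1`, `λ > 0`, if `(α_λ,u_λ)` solves the scaled problem, `w_λ = du_λ/dλ`
solves the linearized problem, and the first constrained eigenvalue is positive, then
`dα_λ/dλ = −<w_λ>_λ < 0`. -/
theorem stmt9 {N : ℕ} (Ω : Set (EN N)) (hΩo : IsOpen Ω) (hΩb : IsBounded Ω)
    (hvol : volume Ω = 1)
    (p q lam : ℝ) (hp : 1 < p) (hq : 1 / p + 1 / q = 1) (hlam : 0 < lam)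
    (α : ℝ) (hα : 0 < α) (u wl : EN N → ℝ) (hu : ContDiff ℝ 2 u) (hwl : ContDiff ℝ 2 wl)
    (w ρ : EN N → ℝ) (hw : w = fun x => (α + u x) ^ (p - 1)) (hρ : ρ = fun x => (α + u x) ^ p)
    -- (α_λ, u_λ) solves the scaled problem
    (heq : ∀ x ∈ Ω, -lap u x = lam * (α + u x) ^ p)
    (hmass : (∫ x in Ω, (α + u x) ^ p) = 1)
    (hupos : ∀ x ∈ Ω, 0 ≤ u x) (hubd : ∀ x ∈ frontier Ω, u x = 0)
    -- w_λ solves the linearized problem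
    (hwleq : ∀ x ∈ Ω, -lap wl x = p * lam * w x * (wl x - wavg Ω w wl) + ρ x)
    (hwlbd : ∀ x ∈ frontier Ω, wl x = 0)
    -- σ₁ > 0
    (hσ : 0 < sInf {r : ℝ | ∃ φ : EN N → ℝ, testfun Ω φ ∧
        r = (dirE Ω φ - p * lam * ∫ x in Ω, w x * (φ x - wavg Ω w φ) ^ 2)
              / ∫ x in Ω, w x * (φ x - wavg Ω w φ) ^ 2})
    -- the branch λ ↦ α_λ, whose derivative at λ is −<w_λ>_λ
    (A : ℝ → ℝ) (hAlam : A lam = α)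
    (hda : HasDerivAt A (-(wavg Ω w wl)) lam) :
    deriv A lam = -(wavg Ω w wl) ∧ deriv A lam < 0 := by
  rw [hda.deriv]
  refine ⟨rfl, ?_⟩
  rw [neg_lt_zero]
  have hne : Ω.Nonempty := by
    rw [nonempty_iff_ne_empty]; rintro rfl; simp at hvol
  have hbpos : ∀ x ∈ Ω, 0 < α + u x := fun x hx => by linarith [hupos x hx]
  have hwpos : ∀ x ∈ Ω, 0 < w x := fun x hx => by
    rw [hw]; exact Real.rpow_pos_of_pos (hbpos x hx) _
  have hρw : ∀ x ∈ Ω, ρ x = w x * (α + u x) := fun x hx => by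
    rw [hw, hρ]
    show (α + u x) ^ p = (α + u x) ^ (p - 1) * (α + u x)
    rw [Real.rpow_sub_one (hbpos x hx).ne', div_mul_cancel₀ _ (hbpos x hx).ne']
  have hwc : ContinuousOn w Ω := by
    rw [hw]
    refine ContinuousOn.rpow_const ?_ fun x hx => Or.inl (hbpos x hx).ne'
    exact (continuous_const.add hu.continuous).continuousOn
  obtain ⟨Cu, hCu0, hCu⟩ := bdd_on hΩb hu.continuous
  obtain ⟨Cv, hCv0, hCv⟩ := bdd_on hΩb hwl.continuous
  set W : ℝ := (α + Cu) ^ (p - 1) with hW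
  have hW0 : 0 ≤ W := by positivity
  have hwW : ∀ x ∈ Ω, |w x| ≤ W := fun x hx => by
    rw [abs_of_pos (hwpos x hx), hw]
    refine Real.rpow_le_rpow (hbpos x hx).le ?_ (by linarith)
    have := (le_abs_self _).trans (hCu x hx)
    linarith
  have hI : ∀ (g : EN N → ℝ), Continuous g → IntegrableOn (fun x => w x * g x) Ω := by
    intro g hg
    obtain ⟨C, hC0, hC⟩ := bdd_on hΩb hg
    refine int_on hΩo hvol (W * C) (hwc.mul hg.continuousOn) fun x hx => ?_
    rw [abs_mul]
    exact mul_le_mul (hwW x hx) (hC x hx) (abs_nonneg _) hW0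
  have hI0 : IntegrableOn w Ω := int_on hΩo hvol W hwc hwW
  have huc := hu.continuous
  have hvc := hwl.continuous
  have hms := hΩo.measurableSet
  have hmpos : 0 < ∫ x in Ω, w x := by
    rw [setIntegral_pos_iff_support_of_nonneg_ae]
    · have : Function.support w ∩ Ω = Ω :=
        inter_eq_right.2 fun x hx => (hwpos x hx).ne'
      rw [this, hvol]; exact one_pos
    · filter_upwards [ae_restrict_mem hms] with x hx using (hwpos x hx).le
    · exact hI0
  -- the cut-off functions satisfy the spectral inequality
  have hcd := cut_cd hΩo hwl hwl hwlbd hwlbd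
  have spec : ∀ n, p * lam * (∫ x in Ω, w x * (cut Ω wl wl n x - wavg Ω w (cut Ω wl wl n)) ^ 2) ≤
      dirE Ω (cut Ω wl wl n) := by
    intro n
    set φ := cut Ω wl wl n with hφ
    have hd0 : 0 ≤ dirE Ω φ := integral_nonneg fun x => by positivity
    have hV0 : 0 ≤ ∫ x in Ω, w x * (φ x - wavg Ω w φ) ^ 2 :=
      setIntegral_nonneg hms fun x hx => mul_nonneg (hwpos x hx).le (sq_nonneg _)
    rcases hV0.eq_or_lt with h | h
    · rw [← h]; simpa using hd0
    · have htest : testfun Ω φ := by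
        refine ⟨hcd n, fun x hx => cut_out hx, ?_⟩
        by_contra! hcon
        have h2 : wavg Ω w φ = 0 := by
          unfold wavg
          rw [setIntegral_congr_fun (g := fun _ => (0 : ℝ)) hms fun x hx => by
            simp [hcon x hx]]
          simp
        rw [setIntegral_congr_fun (g := fun _ => (0 : ℝ)) hms fun x hx => by
            simp [hcon x hx, h2]] at h
        simp at h
      have hbd : BddBelow {r : ℝ | ∃ φ : EN N → ℝ, testfun Ω φ ∧
        r = (dirE Ω φ - p * lam * ∫ x in Ω, w x * (φ x - wavg Ω w φ) ^ 2)
              / ∫ x in Ω, w x * (φ x - wavg Ω w φ) ^ 2} := by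
        by_contra hcon
        rw [Real.sInf_of_not_bddBelow hcon] at hσ
        exact lt_irrefl _ hσ
      have h3 := hσ.trans_le (csInf_le hbd ⟨φ, htest, rfl⟩)
      have h4 := (div_pos_iff_of_pos_right h).1 h3
      linarith
  have hVc := fun n => var_eq (Ω := Ω) hmpos.ne' hI0 (hI _ (hcd n).continuous)
    (hI _ ((hcd n).continuous.pow 2))
  have hcb : ∀ n, ∀ x ∈ Ω, |cut Ω wl wl n x| ≤ Cv := fun n x hx =>
    (cut_abs Ω wl wl n x).trans (hCv x hx)
  have l1 : Tendsto (fun n => ∫ x in Ω, w x * cut Ω wl wl n x) atTop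
      (𝓝 (∫ x in Ω, w x * wl x)) := by
    refine dct hΩo hvol (W * Cv) (fun n => hwc.mul (hcd n).continuous.continuousOn) ?_ ?_
    · intro n x hx
      rw [abs_mul]
      exact mul_le_mul (hwW x hx) (hcb n x hx) (abs_nonneg _) hW0
    · exact fun x hx => (cut_lim wl wl hx).const_mul _
  have l2 : Tendsto (fun n => ∫ x in Ω, w x * cut Ω wl wl n x ^ 2) atTop
      (𝓝 (∫ x in Ω, w x * wl x ^ 2)) := by
    refine dct hΩo hvol (W * Cv ^ 2)
      (fun n => hwc.mul ((hcd n).continuous.pow 2).continuousOn) ?_ ?_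
    · intro n x hx
      rw [abs_mul, abs_pow]
      exact mul_le_mul (hwW x hx) (pow_le_pow_left₀ (abs_nonneg _) (hcb n x hx) 2)
        (by positivity) hW0
    · exact fun x hx => ((cut_lim wl wl hx).pow 2).const_mul _
  have hlim := le_of_tendsto_of_tendsto'
    (((l2.sub ((l1.pow 2).div_const (∫ x in Ω, w x)))).const_mul (p * lam))
    (dirE_lim hΩo hΩb hvol hwl hwlbd) (fun n => by rw [← hVc n]; exact spec n)
  have hsym := green_symm hΩo hΩb hvol hu hwl hubd hwlbd
  have hc : wavg Ω w wl = (∫ x in Ω, w x * wl x) / ∫ x in Ω, w x := rfl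
  set c := wavg Ω w wl with hcdef
  -- rewrite all integrals
  have i1 := hI _ huc
  have i2 := hI _ hvc
  have i3 := hI (fun x => wl x ^ 2) (hvc.pow 2)
  have i4 := hI (fun x => u x * wl x) (huc.mul hvc)
  have i5 := hI (fun x => u x ^ 2) (huc.pow 2)
  have e1 : ∫ x in Ω, wl x * lap wl x = -(p * lam * ((∫ x in Ω, w x * wl x ^ 2)
      - c * ∫ x in Ω, w x * wl x) + α * (∫ x in Ω, w x * wl x)
      + ∫ x in Ω, w x * (u x * wl x)) := by
    refine Eq.trans ?_ ((lin4 i3 i2 i2 i4 (-(p * lam)) (p * lam * c) (-α) (-1)).trans (by ring))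
    refine setIntegral_congr_fun hms fun x hx => ?_
    have h := hwleq x hx
    rw [hρw x hx] at h
    have h' : lap wl x = -(p * lam * w x * (wl x - c) + w x * (α + u x)) := by linarith
    simp only [h']
    ring
  have e2 : ∫ x in Ω, u x * lap wl x = -(p * lam * ((∫ x in Ω, w x * (u x * wl x))
      - c * ∫ x in Ω, w x * u x) + α * (∫ x in Ω, w x * u x)
      + ∫ x in Ω, w x * u x ^ 2) := by
    refine Eq.trans ?_ ((lin4 i4 i1 i1 i5 (-(p * lam)) (p * lam * c) (-α) (-1)).trans (by ring))
    refine setIntegral_congr_fun hms fun x hx => ?_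
    have h := hwleq x hx
    rw [hρw x hx] at h
    have h' : lap wl x = -(p * lam * w x * (wl x - c) + w x * (α + u x)) := by linarith
    simp only [h']
    ring
  have hρw' : ∀ x ∈ Ω, (α + u x) ^ p = w x * (α + u x) := fun x hx => by
    rw [← hρw x hx, hρ]
  have e3 : ∫ x in Ω, wl x * lap u x = -(lam * (α * (∫ x in Ω, w x * wl x)
      + ∫ x in Ω, w x * (u x * wl x))) := by
    rw [← integral_const_mul, ← integral_add (i2.const_mul _) i4, ← integral_const_mul,
      ← integral_neg]
    refine setIntegral_congr_fun hms fun x hx => ?_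
    have h := heq x hx
    rw [hρw' x hx] at h
    have h' : lap u x = -(lam * (w x * (α + u x))) := by linarith
    simp only [h']
    ring
  have e4 : α * (∫ x in Ω, w x) + ∫ x in Ω, w x * u x = 1 := by
    rw [← hmass, ← integral_const_mul, ← integral_add (hI0.const_mul _) i1]
    refine setIntegral_congr_fun hms fun x hx => ?_
    simp only [hρw' x hx]
    ring
  have hY : 0 ≤ ∫ x in Ω, w x * u x ^ 2 :=
    setIntegral_nonneg hms fun x hx => mul_nonneg (hwpos x hx).le (sq_nonneg _)
  have hU : 0 < ∫ x in Ω, w x * u x := by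
    have hnn : ∀ x ∈ Ω, 0 ≤ w x * u x := fun x hx => mul_nonneg (hwpos x hx).le (hupos x hx)
    rcases (setIntegral_nonneg hms hnn).eq_or_lt with h | h
    · exfalso
      have hae := (setIntegral_eq_zero_iff_of_nonneg_ae (by
        filter_upwards [ae_restrict_mem hms] with x hx using hnn x hx) i1).1 h.symm
      have hz := Measure.eqOn_open_of_ae_eq hae hΩo (hwc.mul huc.continuousOn)
        continuousOn_const
      obtain ⟨x, hx⟩ := hne
      have hev : u =ᶠ[𝓝 x] fun _ => (0 : ℝ) := by
        filter_upwards [hΩo.mem_nhds hx] with y hy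
        have : w y * u y = 0 := hz hy
        exact (mul_eq_zero.1 this).resolve_left (hwpos y hy).ne'
      have hl : lap u x = 0 := by
        unfold lap
        rw [(hev.iteratedFDeriv ℝ 2).eq_of_nhds]
        simp
      have h1 := heq x hx
      rw [hl] at h1
      have := mul_pos hlam (Real.rpow_pos_of_pos (hbpos x hx) p)
      linarith
    · exact h
  rw [e1] at hlim
  rw [e2, e3] at hsym
  generalize (∫ x in Ω, w x) = m at *
  generalize (∫ x in Ω, w x * wl x) = a at *
  generalize (∫ x in Ω, w x * wl x ^ 2) = B at *
  generalize (∫ x in Ω, w x * (u x * wl x)) = X at *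
  generalize (∫ x in Ω, w x * u x) = U at *
  generalize (∫ x in Ω, w x * u x ^ 2) = Y at *
  have ha : a = c * m := by rw [hc]; field_simp
  have hq2 : a ^ 2 / m = c * a := by rw [hc]; field_simp
  rw [hq2] at hlim
  have k1 : 0 ≤ α * a + X := by linarith
  have k2 : α * a + X = c + (X - c * U) := by
    have : α * m = 1 - U := by linarith
    calc α * a + X = c * (α * m) + X := by rw [ha]; ring
      _ = _ := by rw [this]; ring
  rw [k2] at k1 hsym
  by_contra! hcn
  have hT : 0 ≤ X - c * U := by linarith
  have hP : 0 < α * U + Y := by positivity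
  nlinarith [mul_nonneg (mul_nonneg (sub_nonneg.2 hp.le) hlam.le) hT,
    mul_nonneg hlam.le (sub_nonneg.2 hcn)]
end
end

section
/- Let p = 1 and λ > 0, and let (α_λ, u_λ) solve −Δu_λ = λ(α_λ + u_λ) in Ω with ∫_Ω (α_λ + u_λ) = 1, u_λ ≥ 0 in Ω, u_λ = 0 on ∂Ω. Let w_λ = du_λ/dλ solve the linearized equation −Δw_λ = λ[w_λ]_λ + (α_λ + u_λ), where [w]_λ = w − ∫_Ω w (note |Ω| = 1, weight ≡ 1). Then the mean of w_λ equals twice the energy: ∫_Ω w_λ = 2E_λ where E_λ = ½∫_Ω (α_λ + u_λ) u_λ /λ · λ = ½∫_Ω ρ_λ ψ_λ with ψ_λ = u_λ/λ; consequently dα_λ/dλ = −2E_λ < 0. -/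
open MeasureTheory Real Bornology Set

noncomputable section

open Filter Topology in
theorem aux_line {N : ℕ} (g : EN N → ℝ) (hg : Continuous g) (v : EN N) :
    ∀ᵐ x : EN N, g x = 0 → lineDeriv ℝ g x v = 0 := by
  let L : ℝ →L[ℝ] EN N := ContinuousLinearMap.smulRight (1 : ℝ →L[ℝ] ℝ) v
  have hm : MeasurableSet {x : EN N | g x = 0 → lineDeriv ℝ g x v = 0} := by
    have h1 : MeasurableSet {x : EN N | g x = 0} := (isClosed_eq hg continuous_const).measurableSet
    have h2 : MeasurableSet {x : EN N | lineDeriv ℝ g x v = 0} :=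
      measurableSet_eq_fun (measurable_lineDeriv hg) measurable_const
    have : {x : EN N | g x = 0 → lineDeriv ℝ g x v = 0}
        = {x : EN N | g x = 0}ᶜ ∪ {x : EN N | lineDeriv ℝ g x v = 0} := by
      ext x
      simp only [mem_ofPred_eq, mem_union, mem_compl_iff]
      tauto
    rw [this]
    exact h1.compl.union h2
  refine ae_mem_of_ae_add_linearMap_mem L.toLinearMap volume volume hm ?_
  intro p
  set φ : ℝ → ℝ := fun t => g (p + t • v) with hφ
  have hc := countable_setOfPred_isolated_right_within (s := {t : ℝ | φ t = 0})
  filter_upwards [hc.ae_notMem volume] with t ht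
  intro h0
  by_contra hne
  apply ht
  have hLt : (L.toLinearMap t) = t • v := by simp [L]
  rw [hLt] at h0 hne
  refine ⟨h0, ?_⟩
  have hd : deriv φ t ≠ 0 := by
    intro h
    apply hne
    have : (fun s : ℝ => g (p + t • v + s • v)) = fun s => φ (t + s) := by
      ext s; simp [hφ, add_smul, add_assoc]
    rw [lineDeriv, this, deriv_comp_const_add, add_zero, h]
  have hev := (differentiableAt_of_deriv_ne_zero hd).hasDerivAt.eventually_ne (c := 0) hd
  rw [← Filter.empty_mem_iff_bot]
  have h1 : ∀ᶠ z in 𝓝[{t : ℝ | φ t = 0} ∩ Ioi t] t, φ z ≠ 0 :=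
    hev.filter_mono (nhdsWithin_mono _ (fun z hz => ne_of_gt hz.2))
  filter_upwards [h1, self_mem_nhdsWithin] with z hz hz2
  exact hz hz2.1

theorem aux_div {N : ℕ} (Ω : Set (EN N)) (hΩo : IsOpen Ω) (hΩb : IsBounded Ω)
    (f : EN N → ℝ) (hf : ContDiff ℝ 1 f) (hbd : ∀ x ∈ frontier Ω, f x = 0) (v : EN N) :
    ∫ x in Ω, fderiv ℝ f x v = 0 := by
  obtain ⟨R, hR⟩ := hΩb.closure.subset_closedBall 0
  have hcomp : IsCompact (Metric.closedBall (0 : EN N) R) := isCompact_closedBall 0 R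
  obtain ⟨C, hC⟩ := hcomp.exists_bound_of_continuousOn
    (hf.continuous_fderiv one_ne_zero).continuousOn
  have hLip : LipschitzOnWith C.toNNReal f (Metric.closedBall (0 : EN N) R) := by
    refine (convex_closedBall 0 R).lipschitzOnWith_of_nnnorm_fderiv_le (𝕜 := ℝ)
      (fun x _ => (hf.differentiable one_ne_zero) x) ?_
    intro x hx
    rw [← norm_toNNReal]
    exact Real.toNNReal_le_toNNReal (hC x hx)
  set g : EN N → ℝ := Ω.indicator f with hgdef
  have hin : ∀ x ∈ Ω, x ∈ Metric.closedBall (0 : EN N) R := fun x hx => hR (subset_closure hx)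
  have key : ∀ x ∈ Ω, ∀ y ∉ Ω, dist (f x) 0 ≤ C.toNNReal * dist x y := by
    intro x hx y hy
    have hex : ∃ z ∈ segment ℝ x y, z ∈ frontier Ω := by
      by_contra hno
      push Not at hno
      have hpre : IsPreconnected (segment ℝ x y) := (convex_segment x y).isPreconnected
      have hyc : y ∉ closure Ω := by
        intro h
        apply hno y (right_mem_segment ℝ x y)
        rw [hΩo.frontier_eq]
        exact ⟨h, hy⟩
      obtain ⟨z, hz⟩ := hpre Ω (closure Ω)ᶜ hΩo isClosed_closure.isOpen_compl
        (by
          intro z hz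
          by_cases hzO : z ∈ Ω
          · exact Or.inl hzO
          · right
            intro h
            apply hno z hz
            rw [hΩo.frontier_eq]
            exact ⟨h, hzO⟩)
        ⟨x, left_mem_segment ℝ x y, hx⟩ ⟨y, right_mem_segment ℝ x y, hyc⟩
      exact hz.2.2 (subset_closure hz.2.1)
    obtain ⟨z, hz, hzf⟩ := hex
    have h1 := hLip.dist_le_mul x (hin x hx) z (hR (frontier_subset_closure hzf))
    rw [hbd z hzf] at h1
    have h2 : dist x z ≤ dist x y := by
      have := dist_add_dist_of_mem_segment hz
      linarith [dist_nonneg (x := z) (y := y)]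
    exact h1.trans (by gcongr)
  have hgL : LipschitzWith C.toNNReal g := by
    refine LipschitzWith.of_dist_le_mul ?_
    intro x y
    by_cases hx : x ∈ Ω <;> by_cases hy : y ∈ Ω
    · simp only [hgdef, indicator_of_mem hx, indicator_of_mem hy]
      exact hLip.dist_le_mul x (hin x hx) y (hin y hy)
    · simp only [hgdef, indicator_of_mem hx, indicator_of_notMem hy]
      exact key x hx y hy
    · simp only [hgdef, indicator_of_notMem hx, indicator_of_mem hy]
      rw [dist_comm, dist_comm x y]
      exact key y hy x hx
    · simp only [hgdef, indicator_of_notMem hx, indicator_of_notMem hy, dist_self]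
      positivity
  have hgc : HasCompactSupport g := by
    refine HasCompactSupport.intro hcomp ?_
    intro x hx
    exact indicator_of_notMem (fun h => hx (hin x h)) f
  have h1 := LipschitzWith.integral_lineDeriv_mul_eq (μ := volume)
    (LipschitzWith.const (α := EN N) (1 : ℝ)) hgL hgc (-v)
  have hc0 : ∀ x : EN N, lineDeriv ℝ (fun _ : EN N => (1 : ℝ)) x (-v) = 0 := by
    intro x
    simp [lineDeriv]
  simp only [hc0, zero_mul, integral_zero, neg_neg, mul_one] at h1
  rw [← integral_indicator hΩo.measurableSet]
  refine Eq.trans ?_ h1.symm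
  apply integral_congr_ae
  filter_upwards [aux_line g hgL.continuous v] with x hx
  by_cases hxO : x ∈ Ω
  · rw [indicator_of_mem hxO]
    have he : g =ᶠ[nhds x] f := by
      filter_upwards [hΩo.mem_nhds hxO] with y hy
      exact indicator_of_mem hy f
    rw [he.lineDeriv_eq, ((hf.differentiable one_ne_zero) x).lineDeriv_eq_fderiv]
  · rw [indicator_of_notMem hxO, hx (indicator_of_notMem hxO f)]

theorem aux_int {N : ℕ} (Ω : Set (EN N)) (hΩb : IsBounded Ω)
    (f : EN N → ℝ) (hf : Continuous f) : IntegrableOn f Ω := by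
  obtain ⟨R, hR⟩ := hΩb.subset_closedBall 0
  exact (hf.continuousOn.integrableOn_compact (isCompact_closedBall (0 : EN N) R)).mono_set hR

theorem aux_green {N : ℕ} (Ω : Set (EN N)) (hΩo : IsOpen Ω) (hΩb : IsBounded Ω)
    (u w : EN N → ℝ) (hu : ContDiff ℝ 2 u) (hw : ContDiff ℝ 2 w)
    (hbd : ∀ x ∈ frontier Ω, w x = 0) :
    ∫ x in Ω, w x * lap u x = - ∫ x in Ω, ∑ i : Fin N,
      fderiv ℝ w x (EuclideanSpace.single i 1) * fderiv ℝ u x (EuclideanSpace.single i 1) := by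
  have hDu : ContDiff ℝ 1 (fderiv ℝ u) := hu.fderiv_right (by norm_num)
  have hDw : ContDiff ℝ 1 (fderiv ℝ w) := hw.fderiv_right (by norm_num)
  have hw1 : ContDiff ℝ 1 w := hw.of_le (by norm_num)
  have hD2 : Continuous (fderiv ℝ (fderiv ℝ u)) := hDu.continuous_fderiv one_ne_zero
  have hDuc := hDu.continuous
  have hDwc := hDw.continuous
  have hwc := hw.continuous
  have hlap : ∀ x, lap u x = ∑ i : Fin N, fderiv ℝ (fderiv ℝ u) x
      (EuclideanSpace.single i 1) (EuclideanSpace.single i 1) := by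
    intro x
    simp [lap, iteratedFDeriv_two_apply]
  have h0 : ∀ i : Fin N, ∫ x in Ω, (w x * fderiv ℝ (fderiv ℝ u) x
      (EuclideanSpace.single i 1) (EuclideanSpace.single i 1) + 
      fderiv ℝ w x (EuclideanSpace.single i 1) * fderiv ℝ u x (EuclideanSpace.single i 1)) = 0 := by
    intro i
    rw [← aux_div Ω hΩo hΩb (fun x => w x * fderiv ℝ u x (EuclideanSpace.single i 1))
      (hw1.mul (hDu.clm_apply contDiff_const)) (fun x hx => by simp [hbd x hx])
      (EuclideanSpace.single i 1)]
    congr 1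
    ext x
    have ha : HasFDerivAt w (fderiv ℝ w x) x := ((hw1.differentiable one_ne_zero) x).hasFDerivAt
    have hb : HasFDerivAt (fderiv ℝ u) (fderiv ℝ (fderiv ℝ u) x) x :=
      ((hDu.differentiable one_ne_zero) x).hasFDerivAt
    have hb2 := hb.clm_apply (hasFDerivAt_const (EuclideanSpace.single i (1:ℝ) : EN N) x)
    have hab : HasFDerivAt (fun x => w x * fderiv ℝ u x (EuclideanSpace.single i 1)) _ x :=
      ha.mul hb2
    rw [hab.fderiv]
    simp
    ring
  have hi1 : ∀ i : Fin N, IntegrableOn (fun x => w x * fderiv ℝ (fderiv ℝ u) x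
      (EuclideanSpace.single i 1) (EuclideanSpace.single i 1)) Ω :=
    fun i => aux_int Ω hΩb _ (by fun_prop)
  have hi2 : ∀ i : Fin N, IntegrableOn (fun x => fderiv ℝ w x (EuclideanSpace.single i 1) * 
      fderiv ℝ u x (EuclideanSpace.single i 1)) Ω :=
    fun i => aux_int Ω hΩb _ (by fun_prop)
  simp_rw [hlap, Finset.mul_sum]
  rw [integral_finsetSum _ (fun i _ => hi1 i), integral_finsetSum _ (fun i _ => hi2 i),
    eq_neg_iff_add_eq_zero, ← Finset.sum_add_distrib]
  refine Finset.sum_eq_zero fun i _ => ?_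
  rw [← integral_add (hi1 i) (hi2 i)]
  exact h0 i

/-- For `p = 1`, `λ > 0`: with weight ≡ 1 and `|Ω| = 1`, the mean of
`w_λ = du_λ/dλ` equals twice the energy `E_λ = ½∫ρ_λψ_λ` (`ψ_λ = u_λ/λ`), and consequently
`dα_λ/dλ = −2E_λ < 0`. -/
theorem stmt10 {N : ℕ} (Ω : Set (EN N)) (hΩo : IsOpen Ω) (hΩb : IsBounded Ω)
    (hvol : volume Ω = 1)
    (lam : ℝ) (hlam : 0 < lam)
    (α : ℝ) (u wl : EN N → ℝ) (hu : ContDiff ℝ 2 u) (hwl : ContDiff ℝ 2 wl)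
    -- (α_λ, u_λ) solves the scaled problem with p = 1
    (heq : ∀ x ∈ Ω, -lap u x = lam * (α + u x))
    (hmass : (∫ x in Ω, (α + u x)) = 1)
    (hupos : ∀ x ∈ Ω, 0 ≤ u x) (hubd : ∀ x ∈ frontier Ω, u x = 0)
    -- w_λ solves the linearized equation −Δw = λ[w] + (α + u), [w] = w − ∫_Ω w
    (hwleq : ∀ x ∈ Ω, -lap wl x = lam * (wl x - ∫ y in Ω, wl y) + (α + u x))
    (hwlbd : ∀ x ∈ frontier Ω, wl x = 0)
    -- the branch λ ↦ α_λ, with dα/dλ = −∫_Ω w_λ from the mass constraint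
    (A : ℝ → ℝ) (hAlam : A lam = α)
    (hda : HasDerivAt A (-(∫ x in Ω, wl x)) lam) :
    (∫ x in Ω, wl x) = 2 * ((1 / 2) * ∫ x in Ω, (α + u x) * (u x / lam)) ∧
    deriv A lam = -(2 * ((1 / 2) * ∫ x in Ω, (α + u x) * (u x / lam))) ∧
    deriv A lam < 0 := by
  have huc := hu.continuous
  have hwc := hwl.continuous
  have hDuc : Continuous (fderiv ℝ u) := hu.continuous_fderiv two_ne_zero
  have hvr : volume.real Ω = 1 := by simp [Measure.real, hvol]
  have hconst : ∀ c : ℝ, IntegrableOn (fun _ : EN N => c) Ω :=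
    fun c => aux_int Ω hΩb _ continuous_const
  have hiu : IntegrableOn u Ω := aux_int Ω hΩb _ huc
  have hiw : IntegrableOn wl Ω := aux_int Ω hΩb _ hwc
  have hiuw : IntegrableOn (fun x => wl x * u x) Ω := aux_int Ω hΩb _ (by fun_prop)
  have hiuu : IntegrableOn (fun x => (α + u x) * u x) Ω := aux_int Ω hΩb _ (by fun_prop)
  set W := ∫ x in Ω, wl x with hW
  set S := ∫ x in Ω, (α + u x) * u x with hS
  have hmass' : α + ∫ x in Ω, u x = 1 := by
    rw [integral_add (hconst α) hiu] at hmass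
    simpa [hvr] using hmass
  have g1 := aux_green Ω hΩo hΩb u wl hu hwl hwlbd
  have g2 := aux_green Ω hΩo hΩb wl u hwl hu hubd
  have g3 := aux_green Ω hΩo hΩb u u hu hu hubd
  have e1 : ∫ x in Ω, wl x * lap u x = -(lam * α) * W - lam * ∫ x in Ω, wl x * u x := by
    rw [hW, ← integral_const_mul, ← integral_const_mul, ← integral_sub (hiw.const_mul _)
      (hiuw.const_mul _)]
    refine setIntegral_congr_fun hΩo.measurableSet fun x hx => ?_
    have := heq x hx
    have h2 : lap u x = -(lam * (α + u x)) := by linarith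
    simp only [h2]
    ring
  have e2 : ∫ x in Ω, u x * lap wl x = (-lam * ∫ x in Ω, wl x * u x)
      + lam * W * (∫ x in Ω, u x) - S := by
    rw [hS, ← integral_const_mul, ← integral_const_mul, ← integral_add (hiuw.const_mul _)
      (hiu.const_mul _), ← integral_sub (aux_int Ω hΩb _ (by fun_prop)) hiuu]
    refine setIntegral_congr_fun hΩo.measurableSet fun x hx => ?_
    have := hwleq x hx
    have h2 : lap wl x = -(lam * (wl x - W) + (α + u x)) := by linarith
    simp only [h2]
    ring
  have e3 : ∫ x in Ω, u x * lap u x = -lam * S := by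
    rw [hS, ← integral_const_mul]
    refine setIntegral_congr_fun hΩo.measurableSet fun x hx => ?_
    have := heq x hx
    have h2 : lap u x = -(lam * (α + u x)) := by linarith
    simp only [h2]
    ring
  have hsymm : ∫ x in Ω, wl x * lap u x = ∫ x in Ω, u x * lap wl x := by
    rw [g1, g2]
    simp_rw [mul_comm]
  have hWS : lam * W = S := by
    rw [e1, e2] at hsymm
    have : (∫ x in Ω, u x) = 1 - α := by linarith
    rw [this] at hsymm
    linarith
  have hE : ∫ x in Ω, (α + u x) * (u x / lam) = W := by
    have : ∫ x in Ω, (α + u x) * (u x / lam) = S / lam := by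
      rw [hS, ← integral_div]
      congr 1
      ext x
      ring
    rw [this, ← hWS]
    field_simp
  have hGc : Continuous (fun x => ∑ i : Fin N, fderiv ℝ u x (EuclideanSpace.single i 1) *
      fderiv ℝ u x (EuclideanSpace.single i 1)) := by fun_prop
  have hG0 : ∀ x, 0 ≤ ∑ i : Fin N, fderiv ℝ u x (EuclideanSpace.single i 1) *
      fderiv ℝ u x (EuclideanSpace.single i 1) :=
    fun x => Finset.sum_nonneg fun i _ => mul_self_nonneg _
  have hSpos : 0 < S := by
    have hLS : lam * S = ∫ x in Ω, ∑ i : Fin N, fderiv ℝ u x (EuclideanSpace.single i 1) *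
      fderiv ℝ u x (EuclideanSpace.single i 1) := by linarith
    by_contra hneg
    have hz : ∫ x in Ω, ∑ i : Fin N, fderiv ℝ u x (EuclideanSpace.single i 1) *
        fderiv ℝ u x (EuclideanSpace.single i 1) = 0 := by
      apply le_antisymm
      · rw [← hLS]
        exact mul_nonpos_of_nonneg_of_nonpos hlam.le (not_lt.mp hneg)
      · exact integral_nonneg hG0
    rw [integral_eq_zero_iff_of_nonneg hG0 (aux_int Ω hΩb _ hGc)] at hz
    have hz2 := Measure.eqOn_open_of_ae_eq hz hΩo hGc.continuousOn continuousOn_const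
    have hcoord : ∀ x ∈ Ω, ∀ i : Fin N, fderiv ℝ u x (EuclideanSpace.single i 1) = 0 := by
      intro x hx i
      have := hz2 hx
      simp only [Pi.zero_apply] at this
      rw [Finset.sum_eq_zero_iff_of_nonneg (fun i _ => mul_self_nonneg _)] at this
      exact mul_self_eq_zero.mp (this i (Finset.mem_univ i))
    have hfd : ∀ x ∈ Ω, fderiv ℝ u x = 0 := by
      intro x hx
      apply ContinuousLinearMap.coe_injective
      refine (EuclideanSpace.basisFun (Fin N) ℝ).toBasis.ext fun i => ?_
      simpa using hcoord x hx i
    have hlap0 : ∀ x ∈ Ω, lap u x = 0 := by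
      intro x hx
      have he : fderiv ℝ u =ᶠ[nhds x] fun _ => 0 := by
        filter_upwards [hΩo.mem_nhds hx] with y hy using hfd y hy
      simp [lap, iteratedFDeriv_two_apply, he.fderiv_eq]
    have : ∫ x in Ω, (α + u x) = ∫ x in Ω, (0 : ℝ) := by
      refine setIntegral_congr_fun hΩo.measurableSet fun x hx => ?_
      have h1 := heq x hx
      rw [hlap0 x hx, neg_zero] at h1
      exact (mul_eq_zero.mp h1.symm).resolve_left hlam.ne'
    rw [hmass] at this
    simp at this
  have hWpos : 0 < W := by
    rw [← hWS] at hSpos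
    exact pos_of_mul_pos_right hSpos hlam.le
  rw [hE, hda.deriv]
  refine ⟨by ring, by ring, by linarith⟩
end
end
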